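/- Let k be a positive integer and let K and K' be virtual knots related by a finite sequence of 2k-moves. Then d_{2k}(K, K') ≥ (1/k) · Σ_{n>0} |J_n(K) − J_n(K')|, where the sum is over all positive integers n (only finitely many terms are nonzero). -/

import Mathlib

/-!
Combinatorial Gauss diagrams.

A Gauss diagram is encoded as a list of chord endpoints read along the
oriented circle from a basepoint.  Each endpoint records the (natural number)
label of its chord, whether it is the terminal endpoint of the (oriented)
chord, and the sign of the chord (`true` = +1, `false` = -1).
Diagrams are considered up to rotation of the basepoint and relabeling of the
chords; these renamings are included among the "Reidemeister" generators.
-/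

structure Endpoint where
  label : ℕ
  isTerminal : Bool
  sign : Bool
deriving DecidableEq

namespace Gauss

/-- The sign (±1) of the chord through an endpoint. -/
def signValue (e : Endpoint) : ℤ := if e.sign then 1 else -1

/-- The sign assigned to an endpoint: `ε` at the terminal endpoint and `-ε`
at the initial endpoint of a chord of sign `ε`. -/
def endpointValue (e : Endpoint) : ℤ := if e.isTerminal then signValue e else -signValue e

/-- The list of chord labels of the endpoints of a word. -/
def labels (L : List Endpoint) : List ℕ := L.map Endpoint.label

/-- A word is a Gauss diagram when every chord label occurring in it occurs
exactly twice, once as an initial and once as a terminal endpoint, with the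
same sign at both occurrences. -/
def IsGaussDiagram (L : List Endpoint) : Prop :=
  ∀ e ∈ L, (L.filter (fun x => x.label == e.label)).length = 2 ∧
    ∃ e' ∈ L, e'.label = e.label ∧ e'.isTerminal = !e.isTerminal ∧ e'.sign = e.sign

/-- Rotate a word so that the first endpoint satisfying `p` comes first. -/
def rotateTo (L : List Endpoint) (p : Endpoint → Bool) : List Endpoint :=
  match L.findIdx? p with
  | some i => L.drop i ++ L.take i
  | none => L

/-- The index of the chord labeled `c`: the sum of the signs assigned to the
endpoints on the arc running from the initial endpoint of the chord to its
terminal endpoint in the direction of the circle's orientation. -/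
def chordIndex (L : List Endpoint) (c : ℕ) : ℤ :=
  ((((rotateTo L (fun e => e.label == c && !e.isTerminal)).drop 1).takeWhile
      (fun e => e.label != c)).map endpointValue).sum

/-- `Jn L n`: the sum of the signs of the chords of `L` of index `n`. -/
def Jn (L : List Endpoint) (n : ℤ) : ℤ :=
  ((L.filter (fun e => e.isTerminal && decide (chordIndex L e.label = n))).map signValue).sum

/-- The odd writhe: the sum of the signs of the chords of odd index,
i.e. `J = Σ_{n odd} J_n`. -/
def oddWrithe (L : List Endpoint) : ℤ :=
  ((L.filter (fun e => e.isTerminal && decide (chordIndex L e.label % 2 ≠ 0))).map signValue).sum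

/-- Moving the basepoint of the circle. -/
def rotateStep (L L' : List Endpoint) : Prop :=
  ∃ x xs, L = x :: xs ∧ L' = xs ++ [x]

/-- Injective relabeling of the chords. -/
def relabelStep (L L' : List Endpoint) : Prop :=
  ∃ f : ℕ → ℕ, Function.Injective f ∧
    L' = L.map (fun e => Endpoint.mk (f e.label) e.isTerminal e.sign)

/-- Reidemeister move I (removal direction): remove an isolated chord whose
two endpoints are adjacent (either orientation, either sign). -/
def reid1 (L L' : List Endpoint) : Prop :=
  ∃ (A B : List Endpoint) (c : ℕ) (t s : Bool),
    c ∉ labels (A ++ B) ∧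
    L = A ++ [Endpoint.mk c t s, Endpoint.mk c (!t) s] ++ B ∧
    L' = A ++ B

/-- Reidemeister move II (removal direction): remove two chords of opposite
signs whose initial endpoints are adjacent and whose terminal endpoints are
adjacent (in either of the two admissible orders). -/
def reid2 (L L' : List Endpoint) : Prop :=
  ∃ (A B C : List Endpoint) (c d : ℕ) (s crossed : Bool),
    c ≠ d ∧ c ∉ labels (A ++ B ++ C) ∧ d ∉ labels (A ++ B ++ C) ∧
    L = A ++ [Endpoint.mk c false s, Endpoint.mk d false (!s)] ++ B ++
        (if crossed then [Endpoint.mk c true s, Endpoint.mk d true (!s)]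
         else [Endpoint.mk d true (!s), Endpoint.mk c true s]) ++ C ∧
    L' = A ++ B ++ C

/-- Reidemeister move III (a standard variant; together with the moves I, II,
rotations and relabelings it generates all versions of the third move). -/
def reid3 (L L' : List Endpoint) : Prop :=
  ∃ (A B C D : List Endpoint) (a b c : ℕ) (s : Bool),
    a ≠ b ∧ b ≠ c ∧ a ≠ c ∧
    L = A ++ [Endpoint.mk b false s, Endpoint.mk a false s] ++ B ++
        [Endpoint.mk a true s, Endpoint.mk c false (!s)] ++ C ++
        [Endpoint.mk b true s, Endpoint.mk c true (!s)] ++ D ∧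
    L' = A ++ [Endpoint.mk a false s, Endpoint.mk b false s] ++ B ++
        [Endpoint.mk c false (!s), Endpoint.mk a true s] ++ C ++
        [Endpoint.mk c true (!s), Endpoint.mk b true s] ++ D

/-- A single Reidemeister generator (including diagram renamings). -/
def reidStep (L L' : List Endpoint) : Prop :=
  rotateStep L L' ∨ relabelStep L L' ∨ reid1 L L' ∨ reid2 L L' ∨ reid3 L L'

/-- A Ξ-move: exchange the first and third of three consecutive endpoints
belonging to three distinct chords, keeping all signs and orientations. -/
def xiStep (L L' : List Endpoint) : Prop :=
  ∃ (A B : List Endpoint) (x y z : Endpoint),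
    x.label ≠ y.label ∧ y.label ≠ z.label ∧ x.label ≠ z.label ∧
    L = A ++ [x, y, z] ++ B ∧
    L' = A ++ [z, y, x] ++ B

/-- A 2k-move (removal direction): remove `2k` chords `c 0, …, c (2k-1)`, all
of sign `s`, whose `p`-endpoints appear consecutively on one arc and whose
`q`-endpoints appear consecutively on a disjoint arc, the chord `c i` being
oriented from `p` to `q` for even `i` (the paper's odd `i`, 1-indexed) and
from `q` to `p` for odd `i`, so initial and terminal endpoints alternate. -/
def move2k (k : ℕ) (L L' : List Endpoint) : Prop :=
  ∃ (A B C : List Endpoint) (c : ℕ → ℕ) (s : Bool),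
    (∀ i < 2 * k, ∀ j < 2 * k, c i = c j → i = j) ∧
    (∀ i < 2 * k, c i ∉ labels (A ++ B ++ C)) ∧
    L = A ++ (List.range (2 * k)).map (fun i => Endpoint.mk (c i) (decide (i % 2 = 1)) s)
          ++ B ++
        (List.range (2 * k)).map (fun i => Endpoint.mk (c i) (decide (i % 2 = 0)) s)
          ++ C ∧
    L' = A ++ B ++ C

/-- A crossing change: reverse the sign and the orientation of one chord. -/
def crossingChange (L L' : List Endpoint) : Prop :=
  ∃ c : ℕ,
    L' = L.map (fun e =>
      if e.label = c then Endpoint.mk e.label (!e.isTerminal) (!e.sign) else e)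

/-- Finite sequences of moves from `r`, performed in either direction. -/
def Moves (r : List Endpoint → List Endpoint → Prop) :
    List Endpoint → List Endpoint → Prop :=
  Relation.ReflTransGen (fun L L' => r L L' ∨ r L' L)

/-- Related by Reidemeister moves: the two words represent the same virtual knot. -/
def ReidEquiv : List Endpoint → List Endpoint → Prop := Moves reidStep

/-- Related by a finite sequence of 2k-moves (and Reidemeister moves). -/
def Rel2k (k : ℕ) : List Endpoint → List Endpoint → Prop :=
  Moves (fun L L' => reidStep L L' ∨ move2k k L L')

/-- Related by a finite sequence of Ξ-moves (and Reidemeister moves). -/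
def RelXi : List Endpoint → List Endpoint → Prop :=
  Moves (fun L L' => reidStep L L' ∨ xiStep L L')

/-- Related by a finite sequence of 2k-moves and Ξ-moves (and Reidemeister moves). -/
def Rel2kXi (k : ℕ) : List Endpoint → List Endpoint → Prop :=
  Moves (fun L L' => reidStep L L' ∨ move2k k L L' ∨ xiStep L L')

/-- Related by a finite sequence of crossing changes and Ξ-moves
(and Reidemeister moves). -/
def RelCCXi : List Endpoint → List Endpoint → Prop :=
  Moves (fun L L' => reidStep L L' ∨ crossingChange L L' ∨ xiStep L L')

/-- A shell-pair of sign `s`: two chords `c`, `d` of sign `s` whose four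
endpoints are consecutive, interleaved as 1st-3rd and 2nd-4th
(with arbitrary orientations `t`, `u` of the two shells). -/
def shellPair (c d : ℕ) (t u s : Bool) : List Endpoint :=
  [Endpoint.mk c t s, Endpoint.mk d u s, Endpoint.mk c (!t) s, Endpoint.mk d (!u) s]

/-- The Gauss diagram `G(a)`: `|a|` consecutive shell-pairs of sign `+1` if
`a > 0` and of sign `-1` if `a < 0`; `G(0)` has no chords.  It represents the
virtual knot `K(a)`. -/
def Gword (a : ℤ) : List Endpoint :=
  ((List.range a.natAbs).map
    (fun j => shellPair (2 * j) (2 * j + 1) false false (decide (0 < a)))).flatten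

/-- `Rel2kCount k m G G'`: `G` and `G'` are related by a finite sequence of
Reidemeister moves and exactly `m` 2k-moves. -/
inductive Rel2kCount (k : ℕ) : ℕ → List Endpoint → List Endpoint → Prop
  | refl (L : List Endpoint) : Rel2kCount k 0 L L
  | reid {m : ℕ} {L L' L'' : List Endpoint} :
      reidStep L L' ∨ reidStep L' L →
      Rel2kCount k m L' L'' → Rel2kCount k m L L''
  | move {m : ℕ} {L L' L'' : List Endpoint} :
      move2k k L L' ∨ move2k k L' L →
      Rel2kCount k m L' L'' → Rel2kCount k (m + 1) L L''

/-- The 2k-move distance: the minimal number of 2k-moves needed to relate the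
two diagrams (together with Reidemeister moves). -/
noncomputable def dist2k (k : ℕ) (L L' : List Endpoint) : ℕ :=
  sInf {m | Rel2kCount k m L L'}

end Gauss

namespace Gauss

/-- `+1` for terminal endpoints, `-1` for initial ones. -/
def sg (e : Endpoint) : ℤ := if e.isTerminal then 1 else -1

/-- Signed sum of the prefix sums before the endpoints labelled `c`. -/
def DD : ℤ → List Endpoint → ℕ → ℤ
  | _, [], _ => 0
  | a, e :: L, c => (if e.label = c then sg e * a else 0) + DD (a + endpointValue e) L c

/-- Total value of a word. -/
def VV (L : List Endpoint) : ℤ := (L.map endpointValue).sum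

/-- Writhe with respect to an arbitrary weight on labels. -/
def JJ (w : ℕ → ℤ) : List Endpoint → ℤ → ℤ
  | [], _ => 0
  | e :: L, n => (if e.isTerminal = true ∧ w e.label + signValue e = n then signValue e else 0)
      + JJ w L n

/-- Endpoints with label `c`. -/
def FF (L : List Endpoint) (c : ℕ) : List Endpoint := L.filter (fun x => x.label == c)

/-- Convenient form of being a Gauss diagram. -/
def IsG (L : List Endpoint) : Prop :=
  ∀ c, FF L c = [] ∨ ∃ t s, FF L c = [Endpoint.mk c t s, Endpoint.mk c (!t) s]

@[simp] lemma VV_nil : VV [] = 0 := rfl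
@[simp] lemma VV_cons (e L) : VV (e :: L) = endpointValue e + VV L := by simp [VV]
@[simp] lemma VV_append (L M) : VV (L ++ M) = VV L + VV M := by simp [VV]
@[simp] lemma DD_nil (a c) : DD a [] c = 0 := rfl
@[simp] lemma DD_cons (a e L c) : DD a (e :: L) c =
  (if e.label = c then sg e * a else 0) + DD (a + endpointValue e) L c := rfl
@[simp] lemma DD_append (a L M c) : DD a (L ++ M) c = DD a L c + DD (a + VV L) M c := by
  induction L generalizing a with
  | nil => simp
  | cons e L ih => simp [ih, add_assoc]
@[simp] lemma JJ_nil (w n) : JJ w [] n = 0 := rfl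
@[simp] lemma JJ_cons (w e L n) : JJ w (e :: L) n =
  (if e.isTerminal = true ∧ w e.label + signValue e = n then signValue e else 0) + JJ w L n := rfl
@[simp] lemma JJ_append (w L M n) : JJ w (L ++ M) n = JJ w L n + JJ w M n := by
  induction L with
  | nil => simp
  | cons e L ih => simp [ih, add_assoc]
@[simp] lemma FF_nil (c) : FF [] c = [] := rfl
@[simp] lemma FF_cons (e L c) : FF (e :: L) c = if e.label = c then e :: FF L c else FF L c := by
  simp [FF, List.filter_cons]
@[simp] lemma FF_append (L M c) : FF (L ++ M) c = FF L c ++ FF M c := by simp [FF]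
@[simp] lemma labels_nil : labels [] = [] := rfl
@[simp] lemma labels_cons (e L) : labels (e :: L) = e.label :: labels L := rfl
@[simp] lemma labels_append (L M) : labels (L ++ M) = labels L ++ labels M := by simp [labels]

lemma FF_eq_nil {L c} (h : c ∉ labels L) : FF L c = [] := by
  induction L with
  | nil => rfl
  | cons e L ih => simp at h; simp [ih h.2, Ne.symm h.1]

lemma DD_notMem {L c} (h : c ∉ labels L) (a) : DD a L c = 0 := by
  induction L generalizing a with
  | nil => rfl
  | cons e L ih => simp at h; simp [ih h.2, Ne.symm h.1]

lemma JJ_congr {w w' : ℕ → ℤ} {L} (h : ∀ c ∈ labels L, w c = w' c) (n) : JJ w L n = JJ w' L n := by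
  induction L with
  | nil => rfl
  | cons e L ih => simp at h; simp [ih h.2, h.1]

lemma DD_acc (a L c) : DD a L c = DD 0 L c + a * ((FF L c).map sg).sum := by
  induction L generalizing a with
  | nil => simp
  | cons e L ih =>
    rw [DD_cons, DD_cons, ih (a + _), ih (0 + _)]
    split_ifs with h <;> simp [h] <;> ring

lemma IsG.DD {L} (h : IsG L) (a c) : DD a L c = DD 0 L c := by
  rw [DD_acc]
  rcases h c with h | ⟨t, s, h⟩ <;> rw [h] <;> simp [sg]
  cases t <;> simp

lemma VV_eq_sum (L : List Endpoint) (S : Finset ℕ) (hS : ∀ c ∈ labels L, c ∈ S) :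
    VV L = ∑ c ∈ S, VV (FF L c) := by
  induction L with
  | nil => simp
  | cons e L ih =>
    simp at hS
    rw [VV_cons, ih hS.2]
    have : ∀ c ∈ S, VV (FF (e :: L) c) = (if e.label = c then endpointValue e else 0) + VV (FF L c) := by
      intro c _; rw [FF_cons]; split_ifs <;> simp
    rw [Finset.sum_congr rfl this, Finset.sum_add_distrib]
    simp [hS.1]

lemma IsG.VV {L} (h : IsG L) : VV L = 0 := by
  rw [VV_eq_sum L (labels L).toFinset (by simp)]
  apply Finset.sum_eq_zero
  intro c _
  rcases h c with h | ⟨t, s, h⟩ <;> rw [h] <;> simp [endpointValue, signValue]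
  cases t <;> simp

lemma isG_of {L} (h : IsGaussDiagram L) : IsG L := by
  intro c
  by_cases hc : c ∈ labels L
  · right
    obtain ⟨e, he, rfl⟩ := List.mem_map.1 hc
    obtain ⟨h1, e', he', h2, h3, h4⟩ := h e he
    have m1 : e ∈ FF L e.label := by simp [FF, he]
    have m2 : e' ∈ FF L e.label := by simp [FF, he', h2]
    change (FF L e.label).length = 2 at h1
    obtain ⟨x, y, hxy⟩ := List.length_eq_two.1 h1
    rw [hxy] at m1 m2 ⊢
    obtain ⟨l, t, s⟩ := e
    obtain ⟨l', t', s'⟩ := e'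
    simp at h2 h3 h4 m1 m2
    subst h2 h3 h4
    rcases m1 with rfl | rfl <;> rcases m2 with m2 | m2
    · cases t <;> simp at m2
    · exact ⟨t, s', by rw [← m2]⟩
    · exact ⟨!t, s', by rw [← m2]; simp⟩
    · cases t <;> simp at m2
  · exact Or.inl (FF_eq_nil hc)

lemma notMem_of_FF {L c} (h : FF L c = []) : c ∉ labels L := by
  induction L with
  | nil => simp
  | cons e L ih =>
    rw [FF_cons] at h
    split_ifs at h with h1
    simp [ih h, Ne.symm h1]

lemma split_FF {L c e M} (h : FF L c = e :: M) :
    ∃ A B, L = A ++ e :: B ∧ c ∉ labels A ∧ FF B c = M := by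
  induction L with
  | nil => simp at h
  | cons x L ih =>
    rw [FF_cons] at h
    split_ifs at h with h1
    · simp at h
      exact ⟨[], L, by simp [h.1], by simp, h.2⟩
    · obtain ⟨A, B, rfl, h2, h3⟩ := ih h
      exact ⟨x :: A, B, by simp, by simp [h2, Ne.symm h1], h3⟩

lemma rotateTo_eq (A B : List Endpoint) (e : Endpoint) (p : Endpoint → Bool)
    (hA : ∀ x ∈ A, p x = false) (he : p e = true) :
    rotateTo (A ++ e :: B) p = e :: B ++ A := by
  have : (A ++ e :: B).findIdx? p = some A.length := by
    rw [List.findIdx?_append, List.findIdx?_eq_none_iff.2 (by simpa using hA)]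
    simp [List.findIdx?_cons, he]
  simp [rotateTo, this]

lemma takeWhile_eq (A B : List Endpoint) (e : Endpoint) (c : ℕ)
    (hA : c ∉ labels A) (he : e.label = c) :
    (A ++ e :: B).takeWhile (fun e => e.label != c) = A := by
  induction A with
  | nil => simp [he]
  | cons x A ih => simp at hA; simp [ih hA.2, Ne.symm hA.1]

lemma chordIndex_eq {L} (h : IsG L) {e : Endpoint} (he : e ∈ L) :
    chordIndex L e.label = DD 0 L e.label + signValue e := by
  have hV := h.VV
  have m1 : e ∈ FF L e.label := by simp [FF, he]
  rcases h e.label with h0 | ⟨t, s, h0⟩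
  · simp [h0] at m1
  have hs : e.sign = s := by
    rw [h0] at m1; simp at m1; rcases m1 with m1 | m1 <;> rw [m1]
  generalize e.label = c at *
  have hv : signValue e = if s then 1 else -1 := by simp [signValue, hs]
  obtain ⟨A, B, rfl, hA, hB⟩ := split_FF h0
  obtain ⟨B, C, rfl, hB', hC⟩ := split_FF hB
  clear hB
  have hB := hB'
  have hC := notMem_of_FF hC
  have key : ∀ X : List Endpoint, c ∉ labels X → ∀ x ∈ X, (x.label == c && !x.isTerminal) = false := by
    intro X hX x hx
    have : x.label ≠ c := by rintro rfl; exact hX (List.mem_map_of_mem hx)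
    simp [this]
  unfold chordIndex
  cases t
  · rw [rotateTo_eq _ _ _ _ (key A hA) (by simp)]
    simp only [List.cons_append, List.drop_one, List.tail_cons, List.append_assoc]
    rw [takeWhile_eq B _ _ c hB rfl, hv]
    simp [DD_notMem hA, DD_notMem hB, DD_notMem hC, sg, endpointValue, signValue, VV]
    ring
  · have e1 : A ++ Endpoint.mk c true s :: (B ++ Endpoint.mk c (!true) s :: C)
      = (A ++ Endpoint.mk c true s :: B) ++ Endpoint.mk c (!true) s :: C := by simp
    rw [e1, rotateTo_eq _ _ _ _ _ (by simp)]
    · have e2 : (Endpoint.mk c (!true) s :: C ++ (A ++ Endpoint.mk c true s :: B)).drop 1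
        = (C ++ A) ++ Endpoint.mk c true s :: B := by simp
      rw [e2, takeWhile_eq (C ++ A) _ _ c (by simp [hA, hC]) rfl, hv]
      simp [DD_notMem hA, DD_notMem hB, DD_notMem hC, sg, endpointValue, signValue] at hV ⊢
      change Gauss.VV C + Gauss.VV A = _
      linarith
    · intro x hx
      simp at hx
      rcases hx with hx | rfl | hx
      · exact key A hA x hx
      · simp
      · exact key B hB x hx

lemma Jn_eq {L} (h : IsG L) (n) : Jn L n = JJ (DD 0 L) L n := by
  have : ∀ M : List Endpoint, (∀ e ∈ M, e ∈ L) →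
      ((M.filter (fun e => e.isTerminal && decide (chordIndex L e.label = n))).map signValue).sum
      = JJ (DD 0 L) M n := by
    intro M hM
    induction M with
    | nil => rfl
    | cons e M ih =>
      simp only [List.mem_cons, forall_eq_or_imp] at hM
      rw [JJ_cons, ← ih hM.2, ← chordIndex_eq h hM.1, List.filter_cons]
      by_cases h1 : e.isTerminal = true <;> by_cases h2 : chordIndex L e.label = n <;> simp [h1, h2]
  exact this L (fun _ h => h)

/-! Rotation -/
lemma rotate_isG {L L'} (h : rotateStep L L') : IsG L ↔ IsG L' := by
  obtain ⟨x, xs, rfl, rfl⟩ := h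
  refine forall_congr' fun c => ?_
  by_cases hx : x.label = c
  · simp only [FF_cons, FF_append, FF_nil, hx, if_true]
    generalize FF xs c = M
    constructor
    · rintro (h | ⟨t, s, h⟩)
      · simp at h
      · simp at h; obtain ⟨rfl, rfl⟩ := h
        exact Or.inr ⟨!t, s, by simp⟩
    · rintro (h | ⟨t, s, h⟩)
      · simp at h
      · obtain ⟨rfl, h⟩ := List.append_inj' (s₁ := M) (t₁ := [x]) (s₂ := [⟨c, t, s⟩]) (t₂ := [⟨c, !t, s⟩]) h rfl
        simp at h; subst h
        exact Or.inr ⟨!t, s, by simp⟩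
  · simp [hx]

lemma rotate_J {L L'} (h : rotateStep L L') (hL : IsG L) (n) :
    JJ (DD 0 L) L n = JJ (DD 0 L') L' n := by
  have hL' := (rotate_isG h).1 hL
  obtain ⟨x, xs, rfl, rfl⟩ := h
  have : DD 0 (x :: xs) = DD 0 (xs ++ [x]) := by
    funext c
    have hV := hL.VV
    rw [← hL'.DD (endpointValue x)]
    simp at hV
    simp [hV]
  rw [this]; simp [add_comm]

/-! Relabeling -/
lemma FF_map (L : List Endpoint) {f : ℕ → ℕ} (hf : Function.Injective f) (c) :
    FF (L.map (fun e => Endpoint.mk (f e.label) e.isTerminal e.sign)) (f c) =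
      (FF L c).map (fun e => Endpoint.mk (f e.label) e.isTerminal e.sign) := by
  induction L with
  | nil => rfl
  | cons e L ih => simp [ih, hf.eq_iff]; split_ifs <;> simp

lemma DD_map (L : List Endpoint) {f : ℕ → ℕ} (hf : Function.Injective f) (a c) :
    DD a (L.map (fun e => Endpoint.mk (f e.label) e.isTerminal e.sign)) (f c) = DD a L c := by
  induction L generalizing a with
  | nil => rfl
  | cons e L ih => simp [ih, hf.eq_iff, sg, endpointValue, signValue]

lemma JJ_map (L : List Endpoint) (w : ℕ → ℤ) (f : ℕ → ℕ) (n) :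
    JJ w (L.map (fun e => Endpoint.mk (f e.label) e.isTerminal e.sign)) n
      = JJ (fun c => w (f c)) L n := by
  induction L with
  | nil => rfl
  | cons e L ih => simp only [List.map_cons, JJ_cons, ih]; rfl

lemma relabel_isG {L L'} (h : relabelStep L L') : IsG L ↔ IsG L' := by
  obtain ⟨f, hf, rfl⟩ := h
  constructor
  · intro h c
    by_cases hc : ∃ c0, f c0 = c
    · obtain ⟨c0, rfl⟩ := hc
      rw [FF_map _ hf]
      rcases h c0 with h | ⟨t, s, h⟩
      · simp [h]
      · exact Or.inr ⟨t, s, by simp [h]⟩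
    · left
      apply FF_eq_nil
      simp [labels]
      intro x _ h; exact hc ⟨_, h⟩
  · intro h c
    have := h (f c)
    rw [FF_map _ hf] at this
    rcases this with h | ⟨t, s, h⟩
    · left; simpa using h
    · right
      refine ⟨t, s, ?_⟩
      have hl : (FF L c).length = 2 := by simpa using congrArg List.length h
      obtain ⟨⟨l, t1, s1⟩, ⟨l', t2, s2⟩, hM⟩ := List.length_eq_two.1 hl
      rw [hM] at h ⊢
      simp [hf.eq_iff] at h ⊢
      exact h

lemma relabel_J {L L'} (h : relabelStep L L') (n) :
    JJ (DD 0 L) L n = JJ (DD 0 L') L' n := by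
  obtain ⟨f, hf, rfl⟩ := h
  rw [JJ_map]
  simp only [DD_map _ hf]

/-! Reidemeister moves -/
lemma reid1_isG {L L'} (h : reid1 L L') : IsG L ↔ IsG L' := by
  obtain ⟨A, B, c, t, s, hc, rfl, rfl⟩ := h
  refine forall_congr' fun d => ?_
  by_cases hd : c = d
  · subst hd
    have h0 := FF_eq_nil hc
    simp at hc
    simp [FF_eq_nil hc.1, FF_eq_nil hc.2]
  · simp [hd]

lemma reid1_J {L L'} (h : reid1 L L') (n) (hn : n ≠ 0) :
    JJ (DD 0 L) L n = JJ (DD 0 L') L' n := by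
  obtain ⟨A, B, c, t, s, hc, rfl, rfl⟩ := h
  have key : ∀ d ∈ labels (A ++ B), DD 0 (A ++ [Endpoint.mk c t s, Endpoint.mk c (!t) s] ++ B) d
      = DD 0 (A ++ B) d := by
    intro d hd
    have : c ≠ d := by rintro rfl; exact hc hd
    cases t <;> simp [this, endpointValue, signValue]
  have hw : DD 0 (A ++ [Endpoint.mk c t s, Endpoint.mk c (!t) s] ++ B) c + (if s then 1 else -1) = 0 := by
    simp at hc
    simp [DD_notMem hc.1, DD_notMem hc.2, sg, endpointValue, signValue]
    cases t <;> cases s <;> simp <;> ring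
  rw [← JJ_congr key]
  generalize DD 0 (A ++ [Endpoint.mk c t s, Endpoint.mk c (!t) s] ++ B) = w at *
  simp [signValue, hw, hn.symm]

lemma reid2_isG {L L'} (h : reid2 L L') : IsG L ↔ IsG L' := by
  obtain ⟨A, B, C, c, d, s, cr, hcd, hc, hd, rfl, rfl⟩ := h
  refine forall_congr' fun x => ?_
  simp at hc hd
  by_cases h1 : c = x
  · subst h1
    cases cr <;> simp [FF_eq_nil hc.1, FF_eq_nil hc.2.1, FF_eq_nil hc.2.2, hcd.symm]
  · by_cases h2 : d = x
    · subst h2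
      cases cr <;> simp [FF_eq_nil hd.1, FF_eq_nil hd.2.1, FF_eq_nil hd.2.2, hcd]
    · cases cr <;> simp [h1, h2]

lemma reid2_J {L L'} (h : reid2 L L') (n) :
    JJ (DD 0 L) L n = JJ (DD 0 L') L' n := by
  obtain ⟨A, B, C, c, d, s, cr, hcd, hc, hd, hL, rfl⟩ := h
  have key : ∀ x ∈ labels (A ++ B ++ C), DD 0 L x = DD 0 (A ++ B ++ C) x := by
    intro x hx
    have h1 : c ≠ x := by rintro rfl; exact hc hx
    have h2 : d ≠ x := by rintro rfl; exact hd hx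
    rw [hL]
    cases cr <;> cases s <;> simp [h1, h2, endpointValue, signValue]
  have hw : DD 0 L c + (if s then 1 else -1) = DD 0 L d - (if s then 1 else -1) := by
    simp at hc hd
    rw [hL]
    cases cr <;> cases s <;> simp [DD_notMem hc.1, DD_notMem hc.2.1, DD_notMem hc.2.2, 
      DD_notMem hd.1, DD_notMem hd.2.1, DD_notMem hd.2.2, hcd, hcd.symm, sg, endpointValue, signValue] <;> ring
  rw [← JJ_congr key]
  generalize DD 0 L = w at *
  rw [hL]
  have hw' : w c = w d - 2 * (if s then 1 else -1) := by linarith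
  cases cr <;> cases s <;> simp [signValue, hw'] <;> ring_nf <;> split_ifs <;> simp

lemma FF_reid3 {L L'} (h : reid3 L L') (x) : FF L x = FF L' x := by
  obtain ⟨A, B, C, D, a, b, c, s, hab, hbc, hac, rfl, rfl⟩ := h
  by_cases h1 : a = x
  · subst h1; simp [hab.symm, hac.symm]
  · by_cases h2 : b = x
    · subst h2; simp [hab, hbc.symm]
    · simp [h1, h2]

lemma reid3_isG {L L'} (h : reid3 L L') : IsG L ↔ IsG L' := by
  refine forall_congr' fun x => ?_
  rw [FF_reid3 h]

lemma reid3_J {L L'} (h : reid3 L L') (n) :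
    JJ (DD 0 L) L n = JJ (DD 0 L') L' n := by
  obtain ⟨A, B, C, D, a, b, c, s, hab, hbc, hac, hL, hL'⟩ := h
  have key : DD 0 L = DD 0 L' := by
    funext x
    rw [hL, hL']
    by_cases h1 : a = x
    · subst h1
      cases s <;> simp [hab.symm, hac.symm, sg, endpointValue, signValue] <;> ring_nf
    · by_cases h2 : b = x
      · subst h2
        cases s <;> simp [hab, hbc.symm, sg, endpointValue, signValue] <;> ring_nf
      · by_cases h3 : c = x
        · subst h3
          cases s <;> simp [hac, hbc, sg, endpointValue, signValue] <;> ring_nf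
        · cases s <;> simp [h1, h2, h3, endpointValue, signValue] <;> ring_nf
  rw [key, hL, hL']
  simp
  ring

lemma reid_isG {L L'} (h : reidStep L L') : IsG L ↔ IsG L' := by
  rcases h with h | h | h | h | h
  · exact rotate_isG h
  · exact relabel_isG h
  · exact reid1_isG h
  · exact reid2_isG h
  · exact reid3_isG h

lemma reid_J {L L'} (h : reidStep L L') (hL : IsG L) (n) (hn : n ≠ 0) :
    JJ (DD 0 L) L n = JJ (DD 0 L') L' n := by
  rcases h with h | h | h | h | h
  · exact rotate_J h hL n
  · exact relabel_J h n
  · exact reid1_J h n hn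
  · exact reid2_J h n
  · exact reid3_J h n

/-! The 2k-move -/

/-- One block of endpoints of a 2k-move; endpoints of indices of parity `r` are terminal. -/
def blk (c : ℕ → ℕ) (s : Bool) (r m : ℕ) : List Endpoint :=
  (List.range m).map (fun i => Endpoint.mk (c i) (decide (i % 2 = r)) s)

lemma blk_succ (c s r m) : blk c s r (m + 1) = blk c s r m ++ [Endpoint.mk (c m) (decide (m % 2 = r)) s] := by
  simp [blk, List.range_succ]

lemma blk_labels {c s r m x} (h : ∀ i < m, c i ≠ x) : x ∉ labels (blk c s r m) := by
  simp [labels, blk]; exact h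

/-- Sign as an integer. -/
def sv (s : Bool) : ℤ := if s then 1 else -1

lemma VV_blk1 (c s m) : VV (blk c s 1 m) = if m % 2 = 0 then 0 else - sv s := by
  induction m with
  | zero => rfl
  | succ m ih =>
    rw [blk_succ, VV_append, ih]
    rcases Nat.mod_two_eq_zero_or_one m with h | h <;>
      simp [h, Nat.add_mod, endpointValue, signValue, sv]

lemma VV_blk0 (c s m) : VV (blk c s 0 m) = if m % 2 = 0 then 0 else sv s := by
  induction m with
  | zero => rfl
  | succ m ih =>
    rw [blk_succ, VV_append, ih]
    rcases Nat.mod_two_eq_zero_or_one m with h | h <;>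
      simp [h, Nat.add_mod, endpointValue, signValue, sv]

lemma DD_blk (c s r m) (hinj : ∀ i < m, ∀ j < m, c i = c j → i = j) (a : ℤ) (i) (hi : i < m) :
    DD a (blk c s r m) (c i) = (if i % 2 = r then 1 else -1) * (a + VV (blk c s r i)) := by
  induction m with
  | zero => omega
  | succ m ih =>
    rw [blk_succ, DD_append]
    by_cases him : i = m
    · subst him
      rw [DD_notMem (blk_labels fun j hj h => by have := hinj j (by omega) i hi h; omega)]
      simp [sg]
    · have : c m ≠ c i := fun h => him (hinj m (by omega) i hi h).symm
      rw [ih (fun i hi j hj => hinj i (by omega) j (by omega)) (by omega)]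
      simp [this]

lemma FF_blk (c s r m) (hinj : ∀ i < m, ∀ j < m, c i = c j → i = j) (i) (hi : i < m) :
    FF (blk c s r m) (c i) = [Endpoint.mk (c i) (decide (i % 2 = r)) s] := by
  induction m with
  | zero => omega
  | succ m ih =>
    rw [blk_succ, FF_append]
    by_cases him : i = m
    · subst him
      rw [FF_eq_nil (blk_labels fun j hj h => by have := hinj j (by omega) i hi h; omega)]
      simp
    · have : c m ≠ c i := fun h => him (hinj m (by omega) i hi h).symm
      rw [ih (fun i hi j hj => hinj i (by omega) j (by omega)) (by omega)]
      simp [this]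

lemma JJ_blk (w : ℕ → ℤ) (c s r k N) (hr : r < 2) (h : ∀ i < 2 * k, i % 2 = r → w (c i) + sv s = N) (n) :
    JJ w (blk c s r (2 * k)) n = if N = n then k * sv s else 0 := by
  induction k with
  | zero => simp [blk]
  | succ k ih =>
    rw [show 2 * (k + 1) = 2 * k + 1 + 1 by ring, blk_succ, blk_succ, JJ_append, JJ_append,
      ih fun i hi => h i (by omega)]
    have h0 := h (2 * k) (by omega)
    have h1 := h (2 * k + 1) (by omega)
    have e : (2 * k + 1) % 2 = 1 := by omega
    have e0 : (2 * k) % 2 = 0 := by omega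
    rw [e0] at h0
    rw [e] at h1
    change _ + (_ + _) + (_ + _) = _
    interval_cases r
    · simp [e, signValue, ← h0, sv]; split_ifs <;> ring
    · simp [e, signValue, ← h1, sv]; split_ifs <;> ring

lemma move_isG {k L L'} (h : move2k k L L') : IsG L ↔ IsG L' := by
  obtain ⟨A, B, C, c, s, hinj, hfr, rfl, rfl⟩ := h
  refine forall_congr' fun x => ?_
  change (FF (A ++ blk c s 1 (2 * k) ++ B ++ blk c s 0 (2 * k) ++ C) x = [] ∨ ∃ _, ∃ _,
    FF (A ++ blk c s 1 (2 * k) ++ B ++ blk c s 0 (2 * k) ++ C) x = _) ↔ _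
  by_cases hx : ∃ i < 2 * k, c i = x
  · obtain ⟨i, hi, rfl⟩ := hx
    have hc := hfr i hi
    simp only [labels_append, List.mem_append, not_or] at hc
    have h1 : (!decide (i % 2 = 1)) = decide (i % 2 = 0) := by
      rcases Nat.mod_two_eq_zero_or_one i with h | h <;> simp [h]
    simp [FF_blk _ _ _ _ hinj i hi, FF_eq_nil hc.1.1, FF_eq_nil hc.1.2, FF_eq_nil hc.2, ← h1]
  · have hx : ∀ i < 2 * k, c i ≠ x := fun i hi h => hx ⟨i, hi, h⟩
    simp [FF_eq_nil (blk_labels hx)]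

lemma move_J {k L L'} (h : move2k k L L') (hL' : IsG L') :
    ∃ (N : ℤ) (s : Bool), ∀ n, JJ (DD 0 L) L n = JJ (DD 0 L') L' n +
      (if N = n then k * sv s else 0) + (if -N = n then k * sv s else 0) := by
  obtain ⟨A, B, C, c, s, hinj, hfr, hL, rfl⟩ := h
  change L = A ++ blk c s 1 (2 * k) ++ B ++ blk c s 0 (2 * k) ++ C at hL
  have hV := hL'.VV
  simp only [VV_append] at hV
  have key : ∀ x ∈ labels (A ++ B ++ C), DD 0 L x = DD 0 (A ++ B ++ C) x := by
    intro x hx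
    have h1 : ∀ i < 2 * k, c i ≠ x := by rintro i hi rfl; exact hfr i hi hx
    rw [hL]
    simp [DD_notMem (blk_labels h1), VV_blk1, VV_blk0]
  have hw : ∀ i < 2 * k, DD 0 L (c i) + sv s = 
      if i % 2 = 0 then VV B + sv s else -(VV B + sv s) := by
    intro i hi
    have hc := hfr i hi
    simp only [labels_append, List.mem_append, not_or] at hc
    rw [hL]
    simp only [DD_append, DD_notMem hc.1.1, DD_notMem hc.1.2, DD_notMem hc.2, DD_blk _ _ _ _ hinj _ i hi,
      VV_append, VV_blk1, VV_blk0]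
    rcases Nat.mod_two_eq_zero_or_one i with h | h <;> simp [h] <;> ring
  refine ⟨VV B + sv s, s, fun n => ?_⟩
  rw [← JJ_congr key]
  generalize DD 0 L = w at *
  rw [hL]
  simp only [JJ_append]
  rw [JJ_blk w c s 0 k (VV B + sv s) (by omega) (fun i hi h => by rw [hw i hi, if_pos h]),
    JJ_blk w c s 1 k (-(VV B + sv s)) (by omega) (fun i hi h => by rw [hw i hi, if_neg (by omega)])]
  ring

lemma move_bound {k L L'} (h : move2k k L L') (hL' : IsG L') (N : ℕ) :
    ∑ n ∈ Finset.range N, |JJ (DD 0 L) L ((n : ℤ) + 1) - JJ (DD 0 L') L' ((n : ℤ) + 1)| ≤ k := by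
  obtain ⟨M, s, hM⟩ := move_J h hL'
  have hb : ∀ n ∈ Finset.range N, |JJ (DD 0 L) L ((n : ℤ) + 1) - JJ (DD 0 L') L' ((n : ℤ) + 1)|
      ≤ if n = M.natAbs - 1 then (k : ℤ) else 0 := by
    intro n _
    rw [hM, add_assoc, add_sub_cancel_left]
    have : |sv s| = 1 := by cases s <;> simp [sv]
    split_ifs <;> first | omega | simp [abs_mul, this]
  refine (Finset.sum_le_sum hb).trans ?_
  rw [Finset.sum_ite_eq']
  split_ifs <;> simp

lemma count_bound {k m L L'} (h : Rel2kCount k m L L') (hL : IsG L) :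
    IsG L' ∧ ∀ N : ℕ, ∑ n ∈ Finset.range N,
      |JJ (DD 0 L) L ((n : ℤ) + 1) - JJ (DD 0 L') L' ((n : ℤ) + 1)| ≤ k * m := by
  induction h with
  | refl L => exact ⟨hL, by simp⟩
  | @reid m L L' L'' h _ ih =>
    have h1 : IsG L' ∧ ∀ n : ℤ, n ≠ 0 → JJ (DD 0 L) L n = JJ (DD 0 L') L' n := by
      rcases h with h | h
      · exact ⟨(reid_isG h).1 hL, reid_J h hL⟩
      · have := (reid_isG h).2 hL
        exact ⟨this, fun n hn => (reid_J h this n hn).symm⟩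
    refine ⟨(ih h1.1).1, fun N => ?_⟩
    convert (ih h1.1).2 N using 4 with n
    exact h1.2 _ (by omega)
  | @move m L L' L'' h _ ih =>
    have h1 : IsG L' ∧ ∀ N : ℕ, ∑ n ∈ Finset.range N,
        |JJ (DD 0 L) L ((n : ℤ) + 1) - JJ (DD 0 L') L' ((n : ℤ) + 1)| ≤ k := by
      rcases h with h | h
      · have := (move_isG h).1 hL
        exact ⟨this, move_bound h this⟩
      · refine ⟨(move_isG h).2 hL, fun N => ?_⟩
        simp_rw [abs_sub_comm (JJ (DD 0 L) L _)]
        exact move_bound h hL N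
    refine ⟨(ih h1.1).1, fun N => ?_⟩
    have a := (ih h1.1).2 N
    have b := h1.2 N
    push_cast
    calc _ ≤ ∑ n ∈ Finset.range N, (|JJ (DD 0 L) L ((n : ℤ) + 1) - JJ (DD 0 L') L' ((n : ℤ) + 1)|
          + |JJ (DD 0 L') L' ((n : ℤ) + 1) - JJ (DD 0 L'') L'' ((n : ℤ) + 1)|) :=
          Finset.sum_le_sum fun n _ => abs_sub_le _ _ _
      _ ≤ _ := by rw [Finset.sum_add_distrib]; linarith

end Gauss

open Gauss in
/-- lower bound for the 2k-move distance:
`d_{2k}(K,K') ≥ (1/k) Σ_{n>0} |J_n(K) - J_n(K')|`. -/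
theorem dist2k_lower_bound (k : ℕ) (hk : 0 < k)
    (G G' : List Endpoint) (hG : IsGaussDiagram G) (hG' : IsGaussDiagram G')
    (h : ∃ m : ℕ, Rel2kCount k m G G') :
    (dist2k k G G' : ℝ) ≥
      (1 / (k : ℝ)) * ∑' n : ℕ, |(Jn G ((n : ℤ) + 1) : ℝ) - (Jn G' ((n : ℤ) + 1) : ℝ)| := by
  have hm : Rel2kCount k (dist2k k G G') G G' := Nat.sInf_mem h
  generalize dist2k k G G' = m at hm
  have hb := (count_bound hm (isG_of hG)).2
  have hk' : (0 : ℝ) < k := by exact_mod_cast hk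
  have : ∑' n : ℕ, |(Jn G ((n : ℤ) + 1) : ℝ) - (Jn G' ((n : ℤ) + 1) : ℝ)| ≤ k * m := by
    refine Real.tsum_le_of_sum_range_le (fun _ => abs_nonneg _) fun N => ?_
    have := hb N
    simp_rw [← Jn_eq (isG_of hG), ← Jn_eq (isG_of hG')] at this
    exact_mod_cast this
  rw [ge_iff_le, one_div, inv_mul_le_iff₀ hk']
  exact this
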